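/- For every z ∈ ℂ and τ with Im τ > 0: θ10(z, 2τ)² = (θ00(z,τ)·θ00(0,τ) − θ01(z,τ)·θ01(0,τ))/2. -/

import Mathlib

open Complex Real

noncomputable def θ00 (z τ : ℂ) : ℂ := jacobiTheta₂ z τ

noncomputable def θ01 (z τ : ℂ) : ℂ := jacobiTheta₂ (z + 1/2) τ

noncomputable def θ10 (z τ : ℂ) : ℂ :=
  Complex.exp ((Real.pi : ℂ) * Complex.I * τ / 4 + Real.pi * Complex.I * z) *
    jacobiTheta₂ (z + τ/2) τ


lemma theta_prod_hasSum (z w τ : ℂ) (hτ : 0 < τ.im) :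
    HasSum (fun p : ℤ × ℤ => jacobiTheta₂_term p.1 z τ * jacobiTheta₂_term p.2 w τ)
      (jacobiTheta₂ z τ * jacobiTheta₂ w τ) := by
  have hz := ((summable_jacobiTheta₂_term_iff z τ).2 hτ).norm
  have hw := ((summable_jacobiTheta₂_term_iff w τ).2 hτ).norm
  have h := (summable_mul_of_summable_norm hz hw).hasSum
  rw [← tsum_mul_tsum_of_summable_norm hz hw] at h
  exact h

lemma theta_term_half (n : ℤ) (z τ : ℂ) :
    jacobiTheta₂_term n (z + 1/2) τ = (-1) ^ n * jacobiTheta₂_term n z τ := by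
  unfold jacobiTheta₂_term
  rw [← Complex.exp_pi_mul_I, ← Complex.exp_int_mul, ← Complex.exp_add]
  congr 1
  ring

theorem theta10_tau_duplication (z τ : ℂ) (hτ : 0 < τ.im) :
    θ10 z (2 * τ) ^ 2 = (θ00 z τ * θ00 0 τ - θ01 z τ * θ01 0 τ) / 2 := by
  have h2 : 0 < (2 * τ).im := by simpa using hτ
  have hR := ((theta_prod_hasSum z 0 τ hτ).sub
    (theta_prod_hasSum (z + 1/2) (0 + 1/2) τ hτ)).div_const 2
  have hL := (theta_prod_hasSum (z + (2 * τ)/2) (z + (2 * τ)/2) (2 * τ) h2).mul_left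
    (Complex.exp ((Real.pi : ℂ) * Complex.I * (2 * τ) / 4 + Real.pi * Complex.I * z) ^ 2)
  let g : ℤ × ℤ → ℤ × ℤ := fun p => (p.1 + p.2 + 1, p.1 - p.2)
  have hg : Function.Injective g := by
    rintro ⟨a, b⟩ ⟨c, d⟩ h
    simp only [g, Prod.mk.injEq] at h ⊢
    omega
  rw [← hg.hasSum_iff] at hR
  · unfold θ10 θ00 θ01
    rw [mul_pow, sq (jacobiTheta₂ _ _)]
    refine hL.unique ?_
    refine Eq.mp (congrArg (fun f => HasSum f _) (funext ?_)) hR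
    rintro ⟨a, b⟩
    symm
    simp only [Function.comp, g, theta_term_half]
    have hs : ((-1 : ℂ) ^ (a + b + 1)) * (-1) ^ (a - b) = -1 := by
      rw [← zpow_add₀ (by norm_num), show a + b + 1 + (a - b) = 2 * a + 1 by ring]
      exact Odd.neg_one_zpow ⟨a, rfl⟩
    rw [mul_mul_mul_comm ((-1 : ℂ) ^ (a + b + 1)), hs]
    rw [show ∀ x : ℂ, (x - -1 * x) / 2 = x by intro x; ring]
    unfold jacobiTheta₂_term
    rw [← Complex.exp_nat_mul, ← Complex.exp_add, ← Complex.exp_add, ← Complex.exp_add]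
    congr 1
    push_cast
    ring
  · rintro ⟨m, k⟩ h
    have he : Even (m + k) := by
      by_contra ho
      rw [Int.not_even_iff_odd] at ho
      obtain ⟨a, ha⟩ := ho
      apply h
      refine ⟨(a, m - 1 - a), ?_⟩
      simp only [g, Prod.mk.injEq]
      omega
    have hs : ((-1 : ℂ) ^ m) * (-1) ^ k = 1 := by
      rw [← zpow_add₀ (by norm_num)]
      exact he.neg_one_zpow
    simp only [theta_term_half]
    rw [mul_mul_mul_comm ((-1 : ℂ) ^ m), hs]
    simp
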